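/- Let G be a simple graph and let (V,*) be a travel groupoid on G. Then the right translation system of (V,*), given by V_{u,v} = {w ∈ V | u*w = v}, is a T-partition system on G. -/

import Mathlib

variable {V : Type*}

/-- The right translation system of a groupoid `(V, op)`:
`rts op u v = {w ∈ V | u * w = v}`. -/
def rts (op : V → V → V) (u v : V) : Set V := {w | op u w = v}

/-- Axiom (t1): `(u * v) * u = u` for all `u, v`. -/
def T1 (op : V → V → V) : Prop := ∀ u v : V, op (op u v) u = u

/-- Axiom (t2): if `(u * v) * v = u` then `u = v`. -/
def T2 (op : V → V → V) : Prop := ∀ u v : V, op (op u v) v = u → u = v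

/-- A travel groupoid: a groupoid satisfying (t1) and (t2). -/
def IsTravelGroupoid (op : V → V → V) : Prop := T1 op ∧ T2 op

/-- Axiom (t3) (simple): if `v * u ≠ u` then `u * (v * u) = u * v`. -/
def T3 (op : V → V → V) : Prop := ∀ u v : V, op v u ≠ u → op u (op v u) = op u v

/-- Axiom (t4) (smooth): if `u * v = u * w` then `u * (v * w) = u * v`. -/
def T4 (op : V → V → V) : Prop := ∀ u v w : V, op u v = op u w → op u (op v w) = op u v

/-- Axiom (t5) (semi-smooth): if `u * v = u * w` then
`u * (v * w) = u * v` or `u * ((v * w) * w) = u * v`. -/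
def T5 (op : V → V → V) : Prop :=
  ∀ u v w : V, op u v = op u w →
    op u (op v w) = op u v ∨ op u (op (op v w) w) = op u v

/-- A travel groupoid `(V, op)` is on the graph `G` if the edges of `G` are exactly
the pairs `{u, v}` with `u ≠ v` and `u * v = v`. -/
def IsOnGraph (op : V → V → V) (G : SimpleGraph V) : Prop :=
  ∀ u v : V, G.Adj u v ↔ u ≠ v ∧ op u v = v

/-- The closed neighborhood `N_G[u]` of a vertex `u` in a graph `G`. -/
def closedNbhd (G : SimpleGraph V) (u : V) : Set V := insert u (G.neighborSet u)

/-- A T-partition system on a graph `G`: a family `P u v ⊆ V` indexed by pairs of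
vertices satisfying (P0) (stated as: the sets `P u v` for `v ∈ N_G[u]` cover `V`
and are pairwise disjoint), (P1a), (P1b), (P1c), and (P2). -/
structure IsTPartitionSystem (G : SimpleGraph V) (P : V → V → Set V) : Prop where
  cover : ∀ u a : V, ∃ v ∈ closedNbhd G u, a ∈ P u v
  pairwise_disjoint : ∀ u : V, ∀ v ∈ closedNbhd G u, ∀ w ∈ closedNbhd G u,
    v ≠ w → P u v ∩ P u w = ∅
  p1a : ∀ u : V, P u u = {u}
  p1b : ∀ u v : V, u ≠ v → (v ∈ P u v ↔ G.Adj u v)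
  p1c : ∀ u v : V, u ≠ v → (P u v = ∅ ↔ ¬ G.Adj u v)
  p2 : ∀ u v : V, u ≠ v → P u v ∩ P v u = ∅

/-- Property (R3) (simple T-partition system). -/
def R3 (P : V → V → Set V) : Prop :=
  ∀ u v x y : V, u ∈ P v x → v ∈ P u y → u ≠ x → v ≠ y → x ∈ P u y ∧ y ∈ P v x

/-- Property (R4) (smooth T-partition system). -/
def R4 (P : V → V → Set V) : Prop :=
  ∀ u v x y z : V, x ∈ P u v → y ∈ P u v → y ∈ P x z → z ∈ P u v

/-- Property (R5) (semi-smooth T-partition system). -/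
def R5 (P : V → V → Set V) : Prop :=
  ∀ u v x y z w : V, x ∈ P u v → y ∈ P u v → y ∈ P x z ∩ P z w →
    z ∈ P u v ∨ w ∈ P u v

theorem T1.op_op_self {op : V → V → V} (h : T1 op) (u v : V) : op u (op u v) = op u v := by
  simpa only [h u v] using h (op u v) u

theorem IsTravelGroupoid.op_self {op : V → V → V} (h : IsTravelGroupoid op) (u : V) :
    op u u = u :=
  h.2 (op u u) u (by rw [h.1 u u])

theorem IsTravelGroupoid.op_eq_left_iff {op : V → V → V} (h : IsTravelGroupoid op) {u v : V} :
    op u v = u ↔ v = u := by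
  refine ⟨fun huv => (h.2 u v (by rw [huv, huv])).symm, ?_⟩
  rintro rfl
  exact h.op_self v

theorem stmt4 [Nonempty V] (G : SimpleGraph V) (op : V → V → V)
    (hTG : IsTravelGroupoid op) (hOn : IsOnGraph op G) :
    IsTPartitionSystem G (rts op) where
  cover u a := by
    refine ⟨op u a, ?_, rfl⟩
    by_cases hu : op u a = u
    · exact Or.inl hu
    · exact Or.inr ((hOn _ _).2 ⟨Ne.symm hu, hTG.1.op_op_self u a⟩)
  pairwise_disjoint u v _ w _ hvw :=
    Set.eq_empty_of_forall_notMem fun _ ha => hvw (ha.1.symm.trans ha.2)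
  p1a u := Set.ext fun _ => hTG.op_eq_left_iff
  p1b u v huv := ⟨fun hv => (hOn u v).2 ⟨huv, hv⟩, fun hG => ((hOn u v).1 hG).2⟩
  p1c u v huv := by
    rw [hOn u v, Set.eq_empty_iff_forall_notMem]
    refine ⟨fun hempty hG => hempty v hG.2, fun hG w hw => hG ⟨huv, ?_⟩⟩
    have hw : op u w = v := hw
    simpa only [hw] using hTG.1.op_op_self u w
  p2 u v huv := by
    refine Set.eq_empty_of_forall_notMem fun w hw => huv ?_
    have huw : op u w = v := hw.1
    have hvw : op v w = u := hw.2
    obtain rfl : u = w := hTG.2 u w (by rw [huw, hvw])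
    exact (hTG.op_self u).symm.trans huw
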